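/- arXiv:2004.00194 — 6 statements merged into one kernel-verified Lean document; each statement's English description precedes it below -/
import Mathlib

section
/- Suppose each μ_j^k is continuous. Then V is differentiable on ℝⁿ and its gradient satisfies ∇V(x) = 2 P(x) x for every x ∈ ℝⁿ; equivalently, ∂V/∂x_j (x) = 2 Σ_{k=1}^n p̄_{jk} x_k + 2 x_j Σ_{k=1}^{s_j} d_j^k μ_j^k(x_j) for each j. -/
open Matrix

/-- A product of weights that each sum to one has marginals given by its factors. -/
theorem sum_prod_weight_mul_coord {ι R : Type*} [Fintype ι] [DecidableEq ι] [CommSemiring R]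
    {κ : ι → Type*} [∀ i, Fintype (κ i)] (w f : (i : ι) → κ i → R)
    (hw : ∀ i, ∑ k, w i k = 1) (m : ι) :
    ∑ α : (∀ i, κ i), (∏ i, w i (α i)) * f m (α m) = ∑ k, w m k * f m k := by
  have h := Finset.prod_univ_sum (fun i => (Finset.univ : Finset (κ i)))
    (fun i k => w i k * if i = m then f i k else 1)
  rw [Fintype.piFinset_univ] at h
  simp only [Finset.prod_mul_distrib, Finset.prod_ite_eq', Finset.mem_univ, if_true] at h
  rw [← h, Finset.prod_eq_single m]
  · simp
  · intro i _ hi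
    simp [hi, hw]
  · simp

/-- Product weights that each sum to one have total mass one. -/
theorem sum_prod_weight {ι R : Type*} [Fintype ι] [DecidableEq ι] [CommSemiring R]
    {κ : ι → Type*} [∀ i, Fintype (κ i)] (w : (i : ι) → κ i → R)
    (hw : ∀ i, ∑ k, w i k = 1) :
    ∑ α : (∀ i, κ i), ∏ i, w i (α i) = 1 := by
  rw [← Fintype.piFinset_univ, ← Finset.prod_univ_sum]
  simp [hw]

/-- Blending `A + diagonal` with product weights blends each diagonal entry separately. -/
theorem sum_prod_weight_smul_add_diagonal {ι R : Type*} [Fintype ι] [DecidableEq ι]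
    [CommSemiring R] {κ : ι → Type*} [∀ i, Fintype (κ i)] (w d : (i : ι) → κ i → R)
    (hw : ∀ i, ∑ k, w i k = 1) (A : Matrix ι ι R) :
    ∑ α : (∀ i, κ i), (∏ i, w i (α i)) • (A + Matrix.diagonal fun m => d m (α m))
      = A + Matrix.diagonal fun m => ∑ k, w m k * d m k := by
  simp only [smul_add, Finset.sum_add_distrib, ← Finset.sum_smul, sum_prod_weight w hw, one_smul]
  congr 1
  ext i j
  rw [Matrix.sum_apply]
  by_cases hij : i = j
  · subst hij
    simp [sum_prod_weight_mul_coord w d hw]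
  · simp [hij]

/-- The Fréchet derivative of the quadratic form of a real matrix. -/
theorem hasFDerivAt_dotProduct_mulVec {ι : Type*} [Fintype ι] (A : Matrix ι ι ℝ) (x : ι → ℝ) :
    HasFDerivAt (fun y : ι → ℝ => y ⬝ᵥ A *ᵥ y)
      (∑ i, (x i • ∑ k, A i k • ContinuousLinearMap.proj (R := ℝ) (φ := fun _ : ι => ℝ) k
        + (A *ᵥ x) i • ContinuousLinearMap.proj (R := ℝ) (φ := fun _ : ι => ℝ) i)) x := by
  simp only [dotProduct, Matrix.mulVec]
  refine HasFDerivAt.fun_sum fun i _ => ?_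
  exact (hasFDerivAt_apply i x).mul
    (HasFDerivAt.fun_sum fun k _ => (hasFDerivAt_apply k x).const_mul (A i k))

/-- The Fréchet derivative of a separable integral `∑ j, ∑ k, d j k * ∫ t in 0..x j, g j k t`. -/
theorem hasFDerivAt_sum_integral {ι : Type*} [Fintype ι] {κ : ι → Type*} [∀ i, Fintype (κ i)]
    (d : (i : ι) → κ i → ℝ) (g : (i : ι) → κ i → ℝ → ℝ) (hg : ∀ i k, Continuous (g i k))
    (x : ι → ℝ) :
    HasFDerivAt (fun y : ι → ℝ => ∑ j, ∑ k, d j k * ∫ t in (0:ℝ)..(y j), g j k t)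
      (∑ j, ∑ k, d j k • g j k (x j) •
        ContinuousLinearMap.proj (R := ℝ) (φ := fun _ : ι => ℝ) j) x := by
  refine HasFDerivAt.fun_sum fun j _ => HasFDerivAt.fun_sum fun k _ => HasFDerivAt.const_mul ?_ _
  exact HasDerivAt.comp_hasFDerivAt (f := fun y : ι → ℝ => y j) x
    ((hg j k).integral_hasStrictDerivAt 0 (x j)).hasDerivAt (hasFDerivAt_apply j x)

/-- If each `μ_j^k` is continuous, the line-integral Lyapunov function
`V(x) = xᵀ P̄ x + 2 ∑_j ∑_k d_j^k ∫_0^{x_j} t μ_j^k(t) dt` is differentiable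
with gradient `∇V(x) = 2 P(x) x`, where `P(x) = ∑_α h_α(x) (P̄ + D_α)`;
equivalently `∂V/∂x_j(x) = 2 ∑_k p̄_{jk} x_k + 2 x_j ∑_k d_j^k μ_j^k(x_j)`. -/
theorem stmt_4 (n : ℕ) (hn : 1 ≤ n) (s : Fin n → ℕ) (hs : ∀ j, 1 ≤ s j)
    (μ : (j : Fin n) → Fin (s j) → ℝ → ℝ)
    (hμ0 : ∀ j k t, 0 ≤ μ j k t) (hμ1 : ∀ j k t, μ j k t ≤ 1)
    (hμsum : ∀ (j : Fin n) (t : ℝ), ∑ k, μ j k t = 1)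
    (hcont : ∀ j k, Continuous (μ j k))
    (Pbar : Matrix (Fin n) (Fin n) ℝ) (hPbar : Pbarᵀ = Pbar)
    (hPbardiag : ∀ j, Pbar j j = 0)
    (d : (j : Fin n) → Fin (s j) → ℝ)
    (V : (Fin n → ℝ) → ℝ)
    (hV : ∀ x, V x = x ⬝ᵥ Pbar.mulVec x
        + 2 * ∑ j, ∑ k, d j k * ∫ t in (0:ℝ)..(x j), t * μ j k t) :
    Differentiable ℝ V ∧
    (∀ (x : Fin n → ℝ) (j : Fin n),
      fderiv ℝ V x (Pi.single j 1)
        = 2 * (((∑ α : (∀ l, Fin (s l)), (∏ l, μ l (α l) (x l)) •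
            (Pbar + Matrix.diagonal fun m => d m (α m))).mulVec x) j)) ∧
    (∀ (x : Fin n → ℝ) (j : Fin n),
      fderiv ℝ V x (Pi.single j 1)
        = 2 * (∑ k, Pbar j k * x k) + 2 * x j * ∑ k, d j k * μ j k (x j)) := by
  have hderiv (x : Fin n → ℝ) := (hasFDerivAt_dotProduct_mulVec Pbar x).add
    ((hasFDerivAt_sum_integral d (fun j k t => t * μ j k t)
      (fun j k => continuous_id.mul (hcont j k)) x).const_mul 2)
  have hV' : V = (fun x => x ⬝ᵥ Pbar *ᵥ x) +
      fun x => 2 * ∑ j, ∑ k, d j k * ∫ t in (0:ℝ)..(x j), t * μ j k t := funext hV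
  rw [← hV'] at hderiv
  have hgrad (x : Fin n → ℝ) (j : Fin n) : fderiv ℝ V x (Pi.single j 1)
      = 2 * (∑ k, Pbar j k * x k) + 2 * x j * ∑ k, d j k * μ j k (x j) := by
    rw [(hderiv x).fderiv]
    have hsymm : ∑ i, x i * Pbar i j = ∑ i, Pbar j i * x i :=
      Finset.sum_congr rfl fun i _ => by rw [mul_comm, ← hPbar, Matrix.transpose_apply, hPbar]
    have hsum : ∑ k, d j k * (x j * μ j k (x j)) = x j * ∑ k, d j k * μ j k (x j) := by
      simp only [Finset.mul_sum, mul_left_comm]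
    simp [Pi.single_apply, Finset.sum_add_distrib, Matrix.mulVec, dotProduct, hsymm, hsum]
    ring
  refine ⟨fun x => (hderiv x).differentiableAt, fun x j => ?_, hgrad⟩
  rw [hgrad, sum_prod_weight_smul_add_diagonal (fun l k => μ l k (x l)) d (fun l => hμsum l (x l)),
    Matrix.add_mulVec, Pi.add_apply, Matrix.mulVec_diagonal]
  simp only [Matrix.mulVec, dotProduct, mul_comm (μ _ _ _)]
  ring
end

section
/- Suppose each μ_j^k is continuous. Then the line integral of the vector field f̄(z) = P(z) z is path independent: for every x ∈ ℝⁿ and every continuously differentiable path γ : [0,1] → ℝⁿ with γ(0) = 0 and γ(1) = x, one has 2 ∫_0^1 ⟨P(γ(t)) γ(t), γ'(t)⟩ dt = V(x). -/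
open Matrix

/-- The product weights attached to normalized weight families sum to one. -/
theorem sum_pi_prod_eq_one {ι : Type*} [Fintype ι] [DecidableEq ι] {κ : ι → Type*}
    [∀ i, Fintype (κ i)] (w : (i : ι) → κ i → ℝ) (hw : ∀ i, ∑ k, w i k = 1) :
    ∑ α : (∀ i, κ i), ∏ i, w i (α i) = 1 := by
  rw [← Fintype.prod_sum]
  simp [hw]

/-- Averaging a function of a single index against product weights only sees the corresponding
marginal. -/
theorem sum_pi_prod_mul_apply {ι : Type*} [Fintype ι] [DecidableEq ι] {κ : ι → Type*}
    [∀ i, Fintype (κ i)] (w d : (i : ι) → κ i → ℝ) (hw : ∀ i, ∑ k, w i k = 1) (m : ι) :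
    ∑ α : (∀ i, κ i), (∏ i, w i (α i)) * d m (α m) = ∑ k, w m k * d m k := by
  have h := Fintype.prod_sum fun i k => w i k * (if i = m then d i k else 1)
  simp only [Finset.prod_mul_distrib, Finset.prod_ite_eq', Finset.mem_univ, if_true] at h
  rw [← h, Fintype.prod_eq_single m]
  · simp
  · intro i hi
    simp [hi, hw]

/-- The weighted average of the matrices `A + diagonal (d · (α ·))` is `A` plus the diagonal matrix
of the averaged entries. -/
theorem sum_pi_prod_smul_add_diagonal {ι : Type*} [Fintype ι] [DecidableEq ι] {κ : ι → Type*}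
    [∀ i, Fintype (κ i)] (w d : (i : ι) → κ i → ℝ) (hw : ∀ i, ∑ k, w i k = 1)
    (A : Matrix ι ι ℝ) :
    ∑ α : (∀ i, κ i), (∏ i, w i (α i)) • (A + Matrix.diagonal fun m => d m (α m))
      = A + Matrix.diagonal fun m => ∑ k, w m k * d m k := by
  simp only [smul_add, Finset.sum_add_distrib, ← Finset.sum_smul, sum_pi_prod_eq_one w hw, one_smul]
  congr 1
  ext i j
  rw [Matrix.sum_apply]
  by_cases h : i = j
  · subst h
    simp [sum_pi_prod_mul_apply w d hw]
  · simp [h]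

/-- Derivative of a symmetric quadratic form along a curve. -/
theorem HasDerivAt.dotProduct_mulVec_self {ι : Type*} [Fintype ι] {A : Matrix ι ι ℝ}
    (hA : Aᵀ = A) {γ : ℝ → ι → ℝ} {v : ι → ℝ} {t : ℝ} (hγ : HasDerivAt γ v t) :
    HasDerivAt (fun u => γ u ⬝ᵥ A.mulVec (γ u)) (2 * (A.mulVec (γ t) ⬝ᵥ v)) t := by
  have hc := hasDerivAt_pi.1 hγ
  have h : HasDerivAt (fun u => γ u ⬝ᵥ A.mulVec (γ u))
      (v ⬝ᵥ A.mulVec (γ t) + γ t ⬝ᵥ A.mulVec v) t := by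
    simp only [dotProduct, mulVec, ← Finset.sum_add_distrib]
    exact HasDerivAt.fun_sum fun i _ =>
      (hc i).mul (HasDerivAt.fun_sum fun j _ => (hc j).const_mul (A i j))
  convert h using 1
  rw [dotProduct_mulVec (γ t), ← mulVec_transpose, hA, dotProduct_comm v]
  ring

/-- Derivative of a separable sum of integrals along a curve. -/
theorem HasDerivAt.sum_const_mul_integral {ι : Type*} [Fintype ι] {κ : ι → Type*}
    [∀ i, Fintype (κ i)] {μ : (i : ι) → κ i → ℝ → ℝ} (hμ : ∀ i k, Continuous (μ i k))
    (d : (i : ι) → κ i → ℝ) {γ : ℝ → ι → ℝ} {v : ι → ℝ} {t : ℝ} (hγ : HasDerivAt γ v t) :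
    HasDerivAt (fun u => ∑ j, ∑ k, d j k * ∫ r in (0:ℝ)..(γ u j), r * μ j k r)
      (∑ j, ∑ k, d j k * (γ t j * μ j k (γ t j) * v j)) t := by
  refine HasDerivAt.fun_sum fun j _ => HasDerivAt.fun_sum fun k _ => ?_
  have hc : Continuous fun r : ℝ => r * μ j k r := continuous_id.mul (hμ j k)
  exact ((hc.integral_hasStrictDerivAt 0 (γ t j)).hasDerivAt.comp t
    (hasDerivAt_pi.1 hγ j)).const_mul (d j k)

/-- Path independence of the line integral of `f̄(z) = P(z) z`: for every
`C¹` path `γ` from `0` to `x`, `2 ∫₀¹ ⟨P(γ(t)) γ(t), γ'(t)⟩ dt = V(x)`. -/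
theorem stmt_5 (n : ℕ) (hn : 1 ≤ n) (s : Fin n → ℕ) (hs : ∀ j, 1 ≤ s j)
    (μ : (j : Fin n) → Fin (s j) → ℝ → ℝ)
    (hμ0 : ∀ j k t, 0 ≤ μ j k t) (hμ1 : ∀ j k t, μ j k t ≤ 1)
    (hμsum : ∀ (j : Fin n) (t : ℝ), ∑ k, μ j k t = 1)
    (hcont : ∀ j k, Continuous (μ j k))
    (Pbar : Matrix (Fin n) (Fin n) ℝ) (hPbar : Pbarᵀ = Pbar)
    (hPbardiag : ∀ j, Pbar j j = 0)
    (d : (j : Fin n) → Fin (s j) → ℝ)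
    (V : (Fin n → ℝ) → ℝ)
    (hV : ∀ x, V x = x ⬝ᵥ Pbar.mulVec x
        + 2 * ∑ j, ∑ k, d j k * ∫ t in (0:ℝ)..(x j), t * μ j k t)
    (x : Fin n → ℝ) (γ : ℝ → Fin n → ℝ) (hγ : ContDiff ℝ 1 γ)
    (h0 : γ 0 = 0) (h1 : γ 1 = x) :
    2 * ∫ t in (0:ℝ)..1,
        ((∑ α : (∀ l, Fin (s l)), (∏ l, μ l (α l) (γ t l)) •
            (Pbar + Matrix.diagonal fun m => d m (α m))).mulVec (γ t)) ⬝ᵥ deriv γ t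
      = V x := by
  have hderiv : ∀ t, HasDerivAt γ (deriv γ t) t := fun t =>
    (hγ.differentiable one_ne_zero t).hasDerivAt
  simp only [sum_pi_prod_smul_add_diagonal (fun l k => μ l k (γ _ l)) d (fun l => hμsum l _)]
  have hV' : ∀ t, HasDerivAt (fun u => V (γ u))
      (2 * (((Pbar + Matrix.diagonal fun m => ∑ k, μ m k (γ t m) * d m k).mulVec (γ t))
        ⬝ᵥ deriv γ t)) t := by
    intro t
    simp only [hV]
    refine (((hderiv t).dotProduct_mulVec_self hPbar).add
      (((hderiv t).sum_const_mul_integral hcont d).const_mul 2)).congr_deriv (Eq.symm ?_)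
    rw [add_mulVec, add_dotProduct, mul_add]
    congr 2
    simp only [dotProduct, mulVec_diagonal, Finset.sum_mul]
    refine Finset.sum_congr rfl fun j _ => Finset.sum_congr rfl fun k _ => ?_
    ring
  have hcγ : ∀ j, Continuous fun t => γ t j := fun j => (continuous_apply j).comp hγ.continuous
  have hcγ' : ∀ j, Continuous fun t => deriv γ t j := fun j =>
    (continuous_apply j).comp (hγ.continuous_deriv le_rfl)
  have hint : Continuous fun t =>
      2 * (((Pbar + Matrix.diagonal fun m => ∑ k, μ m k (γ t m) * d m k).mulVec (γ t))
        ⬝ᵥ deriv γ t) := by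
    simp only [add_mulVec, add_dotProduct]
    simp only [dotProduct, mulVec_diagonal]
    simp only [mulVec, dotProduct]
    fun_prop
  rw [← intervalIntegral.integral_const_mul,
    intervalIntegral.integral_eq_sub_of_hasDerivAt (fun t _ => hV' t)
      (hint.intervalIntegrable 0 1), h0, h1]
  simp [hV 0]
end

section
/- Suppose each μ_j^k is continuous and there exists λ₀ > 0 such that ⟨z, P_α z⟩ ≥ λ₀ ‖z‖² for every multi-index α and every z ∈ ℝⁿ. Then V(x) ≥ λ₀ ‖x‖² for all x ∈ ℝⁿ. In particular V(0) = 0, V(x) > 0 for x ≠ 0, and V(x) → ∞ as ‖x‖ → ∞, so V is a positive definite, radially unbounded function. -/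
open Matrix

theorem integral_id_mul_nonneg {f : ℝ → ℝ} (hf : ∀ t, 0 ≤ f t) (x : ℝ) :
    0 ≤ ∫ t in (0 : ℝ)..x, t * f t := by
  rcases le_total 0 x with hx | hx
  · exact intervalIntegral.integral_nonneg hx fun t ht => mul_nonneg ht.1 (hf t)
  · rw [intervalIntegral.integral_symm, ← intervalIntegral.integral_neg]
    refine intervalIntegral.integral_nonneg hx fun t ht => ?_
    rw [neg_nonneg]
    exact mul_nonpos_of_nonpos_of_nonneg ht.2 (hf t)

theorem sum_integral_id_mul_eq {ι : Type*} [Fintype ι] {f : ι → ℝ → ℝ}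
    (hcont : ∀ k, Continuous (f k)) (hsum : ∀ t, ∑ k, f k t = 1) (x : ℝ) :
    ∑ k, ∫ t in (0 : ℝ)..x, t * f k t = x ^ 2 / 2 := by
  have hint (k : ι) : IntervalIntegrable (fun t => t * f k t) MeasureTheory.volume 0 x :=
    (continuous_id.mul (hcont k)).intervalIntegrable 0 x
  rw [← intervalIntegral.integral_finsetSum fun k _ => hint k]
  simp_rw [← Finset.mul_sum, hsum, mul_one]
  simp

/-- Averaging coefficients against the weighted integrals of a partition of unity gives at least
the smallest coefficient times the total integral. -/
theorem mul_sq_le_two_mul_sum_integral {ι : Type*} [Fintype ι] {f : ι → ℝ → ℝ}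
    (hf : ∀ k t, 0 ≤ f k t) (hcont : ∀ k, Continuous (f k)) (hsum : ∀ t, ∑ k, f k t = 1)
    {c : ι → ℝ} {m : ℝ} (hm : ∀ k, m ≤ c k) (x : ℝ) :
    m * x ^ 2 ≤ 2 * ∑ k, c k * ∫ t in (0 : ℝ)..x, t * f k t := by
  have h : ∑ k, m * ∫ t in (0 : ℝ)..x, t * f k t ≤ ∑ k, c k * ∫ t in (0 : ℝ)..x, t * f k t :=
    Finset.sum_le_sum fun k _ =>
      mul_le_mul_of_nonneg_right (hm k) (integral_id_mul_nonneg (hf k) x)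
  rw [← Finset.mul_sum, sum_integral_id_mul_eq hcont hsum] at h
  linarith

/-- If `⟨z, P_α z⟩ ≥ λ₀ ‖z‖²` for all multi-indices `α` (with `λ₀ > 0`), then
the line-integral Lyapunov function satisfies `V(x) ≥ λ₀ ‖x‖²`; in particular
`V(0) = 0`, `V(x) > 0` for `x ≠ 0`, and `V(x) → ∞` as `‖x‖ → ∞`. -/
theorem stmt_6 (n : ℕ) (hn : 1 ≤ n) (s : Fin n → ℕ) (hs : ∀ j, 1 ≤ s j)
    (μ : (j : Fin n) → Fin (s j) → ℝ → ℝ)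
    (hμ0 : ∀ j k t, 0 ≤ μ j k t) (hμ1 : ∀ j k t, μ j k t ≤ 1)
    (hμsum : ∀ (j : Fin n) (t : ℝ), ∑ k, μ j k t = 1)
    (hcont : ∀ j k, Continuous (μ j k))
    (Pbar : Matrix (Fin n) (Fin n) ℝ) (hPbar : Pbarᵀ = Pbar)
    (hPbardiag : ∀ j, Pbar j j = 0)
    (d : (j : Fin n) → Fin (s j) → ℝ)
    (lam : ℝ) (hlam : 0 < lam)
    (hPα : ∀ (α : ∀ l, Fin (s l)) (z : Fin n → ℝ),
      lam * (z ⬝ᵥ z) ≤ z ⬝ᵥ ((Pbar + Matrix.diagonal fun m => d m (α m)).mulVec z))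
    (V : (Fin n → ℝ) → ℝ)
    (hV : ∀ x, V x = x ⬝ᵥ Pbar.mulVec x
        + 2 * ∑ j, ∑ k, d j k * ∫ t in (0:ℝ)..(x j), t * μ j k t) :
    (∀ x : Fin n → ℝ, lam * (x ⬝ᵥ x) ≤ V x) ∧
    V 0 = 0 ∧
    (∀ x : Fin n → ℝ, x ≠ 0 → 0 < V x) ∧
    Filter.Tendsto V (Filter.comap (fun x : Fin n → ℝ => Real.sqrt (x ⬝ᵥ x))
      Filter.atTop) Filter.atTop := by
  have hmin (j : Fin n) : ∃ k₀, ∀ k, d j k₀ ≤ d j k :=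
    have : Nonempty (Fin (s j)) := ⟨⟨0, hs j⟩⟩
    Finite.exists_min (d j)
  choose α hα using hmin
  have hbound (x : Fin n → ℝ) : lam * (x ⬝ᵥ x) ≤ V x := by
    refine (hPα α x).trans ?_
    rw [hV, Matrix.add_mulVec, dotProduct_add, Finset.mul_sum]
    gcongr
    refine Finset.sum_le_sum fun j _ => ?_
    rw [mulVec_diagonal]
    calc x j * (d j (α j) * x j) = d j (α j) * x j ^ 2 := by ring
      _ ≤ _ := mul_sq_le_two_mul_sum_integral (hμ0 j) (hcont j) (hμsum j) (hα j) (x j)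
  have hnonneg (x : Fin n → ℝ) : 0 ≤ x ⬝ᵥ x :=
    Finset.sum_nonneg fun i _ => mul_self_nonneg (x i)
  refine ⟨hbound, by simp [hV], fun x hx => ?_, ?_⟩
  · have hpos : 0 < x ⬝ᵥ x := (hnonneg x).lt_of_ne' (by simpa using hx)
    exact (mul_pos hlam hpos).trans_le (hbound x)
  · have hsq : Filter.Tendsto (fun r : ℝ => lam * r ^ 2) Filter.atTop Filter.atTop :=
      (Filter.tendsto_pow_atTop two_ne_zero).const_mul_atTop hlam
    refine Filter.tendsto_atTop_mono (fun x => ?_) (hsq.comp Filter.tendsto_comap)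
    simpa [Real.sq_sqrt (hnonneg x)] using hbound x
end

section
/- Let s ≥ 1 and let A_i, C_i (1 ≤ i ≤ s) be real n×n matrices, P_j (1 ≤ j ≤ s) symmetric real n×n matrices, and M_j (1 ≤ j ≤ s) symmetric positive semidefinite real n×n matrices. Then for every x ∈ ℝⁿ and every h ∈ ℝ^s with h_i ≥ 0 and Σ_{i=1}^s h_i = 1, Σ_{i=1}^s Σ_{j=1}^s Σ_{k=1}^s h_i h_j h_k · xᵀ [ P_j A_i + (1/2) C_iᵀ M_j C_k ]^S x ≤ Σ_{i=1}^s Σ_{j=1}^s h_i h_j · xᵀ [ (P_j A_i)^S + C_iᵀ M_j C_i ] x. -/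
open Matrix

/-- Young's inequality for the form of a positive semidefinite matrix. -/
theorem Matrix.PosSemidef.dotProduct_mulVec_le {m : Type*} [Fintype m] {M : Matrix m m ℝ}
    (hM : M.PosSemidef) (a b : m → ℝ) :
    a ⬝ᵥ M *ᵥ b ≤ (a ⬝ᵥ M *ᵥ a + b ⬝ᵥ M *ᵥ b) / 2 := by
  have hpos := hM.dotProduct_mulVec_nonneg (a - b)
  have hT : Mᵀ = M := by simpa [conjTranspose_eq_transpose_of_trivial] using hM.isHermitian.eq
  have hsymm : b ⬝ᵥ M *ᵥ a = a ⬝ᵥ M *ᵥ b := by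
    rw [dotProduct_mulVec, ← mulVec_transpose, hT, dotProduct_comm]
  simp only [star_trivial, mulVec_sub, dotProduct_sub, sub_dotProduct] at hpos
  linarith

theorem Matrix.dotProduct_transpose_mulVec_self {m : Type*} [Fintype m] (N : Matrix m m ℝ)
    (x : m → ℝ) : x ⬝ᵥ Nᵀ *ᵥ x = x ⬝ᵥ N *ᵥ x := by
  rw [mulVec_transpose, dotProduct_comm, ← dotProduct_mulVec]

theorem Matrix.dotProduct_transpose_mul_mul_mulVec {m : Type*} [Fintype m]
    (B M D : Matrix m m ℝ) (x : m → ℝ) :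
    x ⬝ᵥ (Bᵀ * M * D) *ᵥ x = (B *ᵥ x) ⬝ᵥ M *ᵥ (D *ᵥ x) := by
  rw [← mulVec_mulVec, ← mulVec_mulVec, dotProduct_mulVec, vecMul_transpose]

/-- Averaging over a third index, with weights summing to one. -/
theorem sum_weights_mul_add_average {ι : Type*} [Fintype ι] (h : ι → ℝ) (hsum : ∑ i, h i = 1)
    (p d : ι → ι → ℝ) :
    ∑ i, ∑ j, ∑ k, h i * h j * h k * (p i j + (d i j + d k j) / 2)
      = ∑ i, ∑ j, h i * h j * (p i j + d i j) := by
  have hleft (f : ι → ι → ℝ) :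
      ∑ i, ∑ j, ∑ k, h i * h j * h k * f i j = ∑ i, ∑ j, h i * h j * f i j := by
    simp_rw [mul_right_comm _ (h _) (f _ _), ← Finset.mul_sum, hsum, mul_one]
  have hright : ∑ i, ∑ j, ∑ k, h i * h j * h k * d k j = ∑ i, ∑ j, h i * h j * d i j := by
    rw [← hleft d, Finset.sum_congr rfl fun i _ => Finset.sum_comm, Finset.sum_comm]
    refine Finset.sum_congr rfl fun k _ => ?_
    rw [Finset.sum_comm]
    exact Finset.sum_congr rfl fun j _ => Finset.sum_congr rfl fun i _ => by ring
  have hsplit (i j k : ι) : h i * h j * h k * (p i j + (d i j + d k j) / 2)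
      = h i * h j * h k * p i j + h i * h j * h k * d i j / 2 + h i * h j * h k * d k j / 2 := by
    ring
  simp_rw [hsplit, Finset.sum_add_distrib, ← Finset.sum_div, hleft, hright, mul_add,
    Finset.sum_add_distrib]
  ring

/-- Convexity estimate: for symmetric `P_j`, positive semidefinite `M_j` and a
convex combination `h`, `∑_{i,j,k} h_i h_j h_k xᵀ[P_j A_i + ½ C_iᵀ M_j C_k]^S x
≤ ∑_{i,j} h_i h_j xᵀ[(P_j A_i)^S + C_iᵀ M_j C_i] x`. -/
theorem stmt_12 (n s : ℕ) (hs : 1 ≤ s)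
    (A C : Fin s → Matrix (Fin n) (Fin n) ℝ)
    (P : Fin s → Matrix (Fin n) (Fin n) ℝ) (hP : ∀ j, (P j)ᵀ = P j)
    (M : Fin s → Matrix (Fin n) (Fin n) ℝ) (hM : ∀ j, (M j).PosSemidef)
    (x : Fin n → ℝ) (h : Fin s → ℝ) (hh : ∀ i, 0 ≤ h i) (hsum : ∑ i, h i = 1) :
    ∑ i, ∑ j, ∑ k, h i * h j * h k *
        (x ⬝ᵥ ((P j * A i + (1/2 : ℝ) • ((C i)ᵀ * M j * C k)
          + (P j * A i + (1/2 : ℝ) • ((C i)ᵀ * M j * C k))ᵀ).mulVec x))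
      ≤ ∑ i, ∑ j, h i * h j *
        (x ⬝ᵥ ((P j * A i + (P j * A i)ᵀ + (C i)ᵀ * M j * C i).mulVec x)) := by
  simp_rw [add_mulVec _ (_ * _ * _), dotProduct_add _ _ ((_ * _ * _) *ᵥ _)]
  rw [← sum_weights_mul_add_average h hsum
    (fun i j => x ⬝ᵥ (P j * A i + (P j * A i)ᵀ) *ᵥ x)
    (fun i j => x ⬝ᵥ ((C i)ᵀ * M j * C i) *ᵥ x)]
  refine Finset.sum_le_sum fun i _ => Finset.sum_le_sum fun j _ => Finset.sum_le_sum fun k _ =>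
    mul_le_mul_of_nonneg_left ?_ (mul_nonneg (mul_nonneg (hh i) (hh j)) (hh k))
  have hyoung := (hM j).dotProduct_mulVec_le (C i *ᵥ x) (C k *ᵥ x)
  simp only [add_mulVec, dotProduct_add, dotProduct_transpose_mulVec_self, smul_mulVec,
    dotProduct_smul, smul_eq_mul, dotProduct_transpose_mul_mul_mulVec]
  linarith
end

section
/- (Lemma 3, decoupling lemma.) Let A be a real n×n matrix. Suppose there exist a real n×n matrix Ω, a symmetric real n×n matrix W, and symmetric positive definite real n×n matrices P and R such that the symmetric 3n×3n block matrix [ [ (AΩ)^S + R + W , AΩ , 0 ] ; [ (AΩ)ᵀ , −(Ω + Ωᵀ) , P − Ω ] ; [ 0 , (P − Ω)ᵀ , −R ] ] is negative definite. Then W + (AP)^S is negative definite. -/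
open Matrix

/-- A congruence of a block matrix by a block column is the double sum of the congruences of its
blocks. -/
lemma blockColumn_transpose_mul_mul {ι m k : Type*} [Fintype ι] [Fintype m]
    (M : ι → ι → Matrix m m ℝ) (B : ι → Matrix m k ℝ) :
    (Matrix.of fun (p : ι × m) j => B p.1 p.2 j)ᵀ *
        (Matrix.of fun p q : ι × m => M p.1 q.1 p.2 q.2) *
        (Matrix.of fun (p : ι × m) j => B p.1 p.2 j) =
      ∑ b, (∑ a, (B a)ᵀ * M a b) * B b := by
  ext i j
  simp [Matrix.mul_apply, Matrix.sum_apply, Fintype.sum_prod_type]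

/-- Lemma 3 (decoupling lemma): if the symmetric `3n × 3n` block matrix
`[[(AΩ)^S + R + W, AΩ, 0]; [(AΩ)ᵀ, −(Ω+Ωᵀ), P−Ω]; [0, (P−Ω)ᵀ, −R]]` is
negative definite (with `W` symmetric, `P, R` symmetric positive definite),
then `W + (AP)^S` is negative definite. -/
theorem stmt_16 (n : ℕ) (A Ω W P R : Matrix (Fin n) (Fin n) ℝ)
    (hW : Wᵀ = W) (hPpd : P.PosDef) (hRpd : R.PosDef)
    (hblock : (-(Matrix.of fun p q : Fin 3 × Fin n =>
        (![![A * Ω + (A * Ω)ᵀ + R + W, A * Ω, 0],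
           ![(A * Ω)ᵀ, -(Ω + Ωᵀ), P - Ω],
           ![0, (P - Ω)ᵀ, -R]] p.1 q.1) p.2 q.2)).PosDef) :
    (-(W + (A * P + (A * P)ᵀ))).PosDef := by
  have hP : Pᵀ = P := hPpd.1
  set B : Fin 3 → Matrix (Fin n) (Fin n) ℝ := ![1, Aᵀ, 1] with hB
  have hinj : Function.Injective
      (Matrix.of fun (p : Fin 3 × Fin n) j => B p.1 p.2 j).mulVec := by
    intro x y hxy
    ext i
    have hi := congrFun hxy (0, i)
    have hone (v : Fin n → ℝ) :
        ((Matrix.of fun (p : Fin 3 × Fin n) j => B p.1 p.2 j) *ᵥ v) (0, i) =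
          ((1 : Matrix (Fin n) (Fin n) ℝ) *ᵥ v) i := rfl
    simpa [hone] using hi
  have hpos := hblock.conjTranspose_mul_mul_same hinj
  rw [Matrix.conjTranspose_eq_transpose_of_trivial, Matrix.mul_neg, Matrix.neg_mul,
    blockColumn_transpose_mul_mul] at hpos
  convert hpos using 2
  simp only [hB, Fin.sum_univ_three, Matrix.cons_val, Matrix.transpose_mul, hP,
    Matrix.transpose_one, Matrix.transpose_transpose, Matrix.transpose_sub]
  noncomm_ring
end

section
/- (Key implication in the proof of Theorem 3.) Let A, C, Ω be real n×n matrices, Q and R symmetric real n×n matrices, X a symmetric positive definite real n×n matrix, D a diagonal positive definite real n×n matrix, and β > 0 a real number. Suppose the symmetric 5n×5n block matrix [ [ (AΩ)^S + R + Q , AΩ , 0 , XCᵀ , XCᵀ ] ; [ (AΩ)ᵀ , −(Ω + Ωᵀ) , X − Ω , 0 , 0 ] ; [ 0 , (X − Ω)ᵀ , −R , 0 , 0 ] ; [ C X , 0 , 0 , −X , 0 ] ; [ C X , 0 , 0 , 0 , −β⁻¹ D⁻¹ ] ] is negative definite. Then (A X)^S + Q + X Cᵀ ( X⁻¹ + β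 D ) C X is negative definite. -/
open Matrix

/-- A block congruence `Tᴴ M T`, where `T` is the block column with blocks `B i`. -/
theorem conjTranspose_blockColumn_mul_mul {ι m k : Type*} [Fintype ι] [Fintype m]
    (F : ι → ι → Matrix m m ℝ) (B : ι → Matrix m k ℝ) :
    (Matrix.of fun (p : ι × m) (c : k) => B p.1 p.2 c)ᴴ
        * (Matrix.of fun p q : ι × m => F p.1 q.1 p.2 q.2)
        * (Matrix.of fun (p : ι × m) (c : k) => B p.1 p.2 c)
      = ∑ i, ∑ j, (B i)ᵀ * F i j * B j := by
  ext a b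
  simp only [Matrix.mul_apply, Matrix.sum_apply, Fintype.sum_prod_type, Matrix.of_apply,
    Matrix.conjTranspose_apply, Matrix.transpose_apply, star_trivial, Finset.sum_mul]
  simp only [Finset.sum_comm (s := (Finset.univ : Finset m)) (t := (Finset.univ : Finset ι))]
  exact Finset.sum_comm

/-- Key implication in the proof of Theorem 3: if the symmetric `5n × 5n`
block matrix
`[[(AΩ)^S+R+Q, AΩ, 0, XCᵀ, XCᵀ]; [(AΩ)ᵀ, −(Ω+Ωᵀ), X−Ω, 0, 0];
  [0, (X−Ω)ᵀ, −R, 0, 0]; [CX, 0, 0, −X, 0]; [CX, 0, 0, 0, −β⁻¹D⁻¹]]`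
is negative definite, then `(AX)^S + Q + XCᵀ(X⁻¹ + βD)CX` is negative
definite. -/
theorem stmt_18 (n : ℕ) (A C Ω : Matrix (Fin n) (Fin n) ℝ)
    (Q R : Matrix (Fin n) (Fin n) ℝ) (hQ : Qᵀ = Q) (hR : Rᵀ = R)
    (X : Matrix (Fin n) (Fin n) ℝ) (hX : X.PosDef)
    (d : Fin n → ℝ) (hd : ∀ i, 0 < d i) (β : ℝ) (hβ : 0 < β)
    (hblock : (-(Matrix.of fun p' q' : Fin 5 × Fin n =>
        (![![A * Ω + (A * Ω)ᵀ + R + Q, A * Ω, 0, X * Cᵀ, X * Cᵀ],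
           ![(A * Ω)ᵀ, -(Ω + Ωᵀ), X - Ω, 0, 0],
           ![0, (X - Ω)ᵀ, -R, 0, 0],
           ![C * X, 0, 0, -X, 0],
           ![C * X, 0, 0, 0, -(β⁻¹ • (Matrix.diagonal d)⁻¹)]] p'.1 q'.1) p'.2 q'.2)).PosDef) :
    (-(A * X + (A * X)ᵀ + Q
        + X * Cᵀ * (X⁻¹ + β • Matrix.diagonal d) * C * X)).PosDef := by
  have hXt : Xᵀ = X := by simpa using hX.isHermitian.eq
  have hXX : X * X⁻¹ = 1 := Matrix.mul_nonsing_inv _ (hX.isUnit.map Matrix.detMonoidHom)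
  have hXit : X⁻¹ᵀ = X⁻¹ := by rw [Matrix.transpose_nonsing_inv, hXt]
  set E := β • Matrix.diagonal d with hE
  have hEt : Eᵀ = E := by simp [hE]
  have hEE : (β⁻¹ • (Matrix.diagonal d)⁻¹) * E = 1 := by
    have hdet : IsUnit (Matrix.diagonal d).det :=
      (Matrix.PosDef.diagonal hd).isUnit.map Matrix.detMonoidHom
    rw [hE, smul_mul_smul_comm, inv_mul_cancel₀ hβ.ne', Matrix.nonsing_inv_mul _ hdet, one_smul]
  generalize β⁻¹ • (Matrix.diagonal d)⁻¹ = G at hblock hEE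
  set F : Fin 5 → Fin 5 → Matrix (Fin n) (Fin n) ℝ :=
    ![![A * Ω + (A * Ω)ᵀ + R + Q, A * Ω, 0, X * Cᵀ, X * Cᵀ],
      ![(A * Ω)ᵀ, -(Ω + Ωᵀ), X - Ω, 0, 0],
      ![0, (X - Ω)ᵀ, -R, 0, 0],
      ![C * X, 0, 0, -X, 0],
      ![C * X, 0, 0, 0, -G]] with hF
  let B : Fin 5 → Matrix (Fin n) (Fin n) ℝ := ![1, Aᵀ, 1, X⁻¹ * C * X, E * C * X]
  have hinj : Function.Injective
      (Matrix.of fun (p : Fin 5 × Fin n) (c : Fin n) => B p.1 p.2 c).mulVec := by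
    intro v w h
    ext i
    simpa [B, Matrix.mulVec, dotProduct, Matrix.one_apply] using congrFun h (0, i)
  have key := hblock.conjTranspose_mul_mul_same hinj
  rw [Matrix.mul_neg, Matrix.neg_mul, conjTranspose_blockColumn_mul_mul] at key
  convert key using 2
  have hXX' : ∀ M, X * (X⁻¹ * M) = M := fun M => by rw [← mul_assoc, hXX, one_mul]
  have hEE' : ∀ M, G * (E * M) = M := fun M => by rw [← mul_assoc, hEE, one_mul]
  simp only [Fin.sum_univ_five, hF, B]
  simp [Matrix.transpose_mul, hXt, hXit, hEt, mul_add, add_mul, mul_sub, sub_mul, mul_assoc,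
    hXX', hEE']
  abel
end
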